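/- arXiv:alg-geom/9607004 — 2 statements merged into one kernel-verified Lean document; each statement's English description precedes it below -/
import Mathlib

section
/- Let (X, σ₀, σ₁) be a connected ribbon graph with v vertices, e edges and c boundary cycles. Then v − e + c ≤ 2 and v − e + c is even; equivalently, 2 − (v − e + c) is a nonnegative even integer, so that the genus g defined by v − e + c = 2 − 2g is a nonnegative integer. (This integer is the genus of the closed oriented surface S(G) obtained from the ribbon graph.) -/
open MulAction Equiv Equiv.Perm

/-- The smallest equivalence relation containing `r` and relating `x` and `y`. -/
def Setoid.merge {α : Type*} (r : Setoid α) (x y : α) : Setoid α where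
  r z w := r z w ∨ (r z x ∨ r z y) ∧ (r w x ∨ r w y)
  iseqv :=
    { refl := fun z => Or.inl (r.refl z)
      symm := by
        rintro z w (h | ⟨h, h'⟩)
        · exact Or.inl (r.symm h)
        · exact Or.inr ⟨h', h⟩
      trans := by
        rintro u v w (h | ⟨h, h'⟩) (k | ⟨k, k'⟩)
        · exact Or.inl (r.trans h k)
        · exact Or.inr ⟨k.imp (r.trans h) (r.trans h), k'⟩
        · exact Or.inr ⟨h, h'.imp (r.trans (r.symm k)) (r.trans (r.symm k))⟩
        · exact Or.inr ⟨h, k'⟩ }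

namespace Setoid

variable {α : Type*}

theorem le_merge (r : Setoid α) (x y : α) : r ≤ r.merge x y := fun _ _ h => Or.inl h

theorem merge_rel (r : Setoid α) (x y : α) : r.merge x y x y :=
  Or.inr ⟨Or.inl (r.refl x), Or.inr (r.refl y)⟩

theorem merge_le {r t : Setoid α} {x y : α} (h : r ≤ t) (hxy : t x y) : r.merge x y ≤ t := by
  have key : ∀ z, r z x ∨ r z y → t z x := fun z hz =>
    hz.elim (fun hz => h hz) fun hz => t.trans (h hz) (t.symm hxy)
  rintro z w (hzw | ⟨hz, hw⟩)
  · exact h hzw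
  · exact t.trans (key z hz) (t.symm (key w hw))

theorem merge_mono {r t : Setoid α} (h : r ≤ t) (x y : α) : r.merge x y ≤ t.merge x y :=
  merge_le (h.trans (le_merge t x y)) (merge_rel t x y)

variable [Finite α]

theorem card_quotient_le {r t : Setoid α} (h : r ≤ t) :
    Nat.card (Quotient t) ≤ Nat.card (Quotient r) :=
  Nat.card_le_card_of_surjective (Quotient.map' id fun _ _ hxy => h hxy) fun q =>
    q.inductionOn fun z => ⟨Quotient.mk r z, rfl⟩

theorem card_quotient_lt {r t : Setoid α} (h : r ≤ t) {x y : α} (hr : ¬ r x y) (ht : t x y) :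
    Nat.card (Quotient t) < Nat.card (Quotient r) := by
  let φ : Quotient r → Quotient t := Quotient.map' id fun _ _ hxy => h hxy
  have hφ : Function.Surjective φ := fun q => q.inductionOn fun z => ⟨Quotient.mk r z, rfl⟩
  refine (card_quotient_le h).lt_of_ne fun hcard => hr ?_
  have hbij := (Nat.bijective_iff_surjective_and_card φ).2 ⟨hφ, hcard.symm⟩
  exact Quotient.exact (hbij.1 (show φ (Quotient.mk r x) = φ (Quotient.mk r y) from
    Quotient.sound ht))

theorem card_quotient_le_merge (r : Setoid α) (x y : α) :
    Nat.card (Quotient r) ≤ Nat.card (Quotient (r.merge x y)) + 1 := by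
  classical
  let φ : Quotient r → Option (Quotient (r.merge x y)) := fun q =>
    if q = Quotient.mk r y then none
    else some (Quotient.map' id (fun _ _ h => le_merge r x y h) q)
  rw [← Finite.card_option]
  refine Nat.card_le_card_of_injective φ fun p q => ?_
  induction p using Quotient.inductionOn with | h z
  induction q using Quotient.inductionOn with | h w
  intro h
  by_cases hz : Quotient.mk r z = Quotient.mk r y <;>
    by_cases hw : Quotient.mk r w = Quotient.mk r y
  · rw [hz, hw]
  · simp [φ, hz, hw] at h
  · simp [φ, hz, hw] at h
  · simp only [φ, hz, hw, if_false, Option.some.injEq] at h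
    have hz' : ¬ r z y := fun h => hz (Quotient.sound h)
    have hw' : ¬ r w y := fun h => hw (Quotient.sound h)
    obtain h | ⟨hzx, hwx⟩ : r.merge x y z w := Quotient.exact h
    · exact Quotient.sound h
    · exact Quotient.sound
        (r.trans (hzx.resolve_right hz') (r.symm (hwx.resolve_right hw')))

end Setoid

namespace Equiv.Perm

variable {α : Type*}

/-- The number of orbits (cycles, including fixed points) of a permutation. -/
noncomputable def numOrbits (f : Perm α) : ℕ := Nat.card (Quotient (SameCycle.setoid f))

theorem setoid_le_iff {f : Perm α} {t : Setoid α} :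
    SameCycle.setoid f ≤ t ↔ ∀ z, t z (f z) := by
  refine ⟨fun h z => h (sameCycle_apply_right.2 (SameCycle.refl f z)), fun h z w hzw => ?_⟩
  obtain ⟨i, rfl⟩ : SameCycle f z w := hzw
  induction i using Int.induction_on with
  | zero => exact t.refl z
  | succ i ih =>
    rw [add_comm, zpow_add, zpow_one, mul_apply]
    exact t.trans ih (h _)
  | pred i ih =>
    refine t.trans ih (t.symm ?_)
    have := h ((f ^ (-(i : ℤ) - 1)) z)
    rwa [← mul_apply, ← zpow_one_add, add_sub_cancel] at this

theorem numOrbits_one : numOrbits (1 : Perm α) = Nat.card α := by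
  refine (Nat.card_eq_of_bijective (Quotient.mk (SameCycle.setoid (1 : Perm α)))
    ⟨fun x y h => ?_, Quotient.mk_surjective⟩).symm
  exact sameCycle_one.1 (Quotient.exact h)

theorem card_orbitRel_zpowers (f : Perm α) :
    Nat.card (orbitRel.Quotient (Subgroup.zpowers f) α) = numOrbits f := by
  have : orbitRel (Subgroup.zpowers f) α = SameCycle.setoid f := by
    ext x y
    change x ∈ orbit (Subgroup.zpowers f) y ↔ SameCycle f x y
    rw [sameCycle_comm]
    constructor
    · rintro ⟨⟨_, i, rfl⟩, h⟩
      exact ⟨i, h⟩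
    · rintro ⟨i, h⟩
      exact ⟨⟨_, i, rfl⟩, h⟩
  rw [numOrbits, orbitRel.Quotient, this]

theorem setoid_sup_eq_top {a b : Perm α}
    (hconn : ∀ x y : α, y ∈ orbit (Subgroup.closure ({a, b} : Set (Perm α))) x) :
    SameCycle.setoid a ⊔ SameCycle.setoid b = ⊤ := by
  set R := SameCycle.setoid a ⊔ SameCycle.setoid b
  have key : ∀ g ∈ Subgroup.closure ({a, b} : Set (Perm α)), ∀ z, R z (g z) := by
    intro g hg
    induction hg using Subgroup.closure_induction with
    | mem g hg =>
      rcases hg with rfl | rfl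
      · exact setoid_le_iff.1 le_sup_left
      · exact setoid_le_iff.1 le_sup_right
    | one => exact fun z => R.refl z
    | mul g h _ _ ihg ihh => exact fun z => R.trans (ihh z) (ihg (h z))
    | inv g _ ih =>
      intro z
      have := ih (g⁻¹ z)
      rw [← mul_apply, mul_inv_cancel, one_apply] at this
      exact R.symm this
  refine top_unique fun x y _ => ?_
  obtain ⟨⟨g, hg⟩, rfl⟩ := hconn x y
  exact key g hg x

variable [DecidableEq α]

theorem setoid_swap_mul_le (f : Perm α) (x y : α) :
    SameCycle.setoid (swap x y * f) ≤ (SameCycle.setoid f).merge x y := by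
  rw [setoid_le_iff]
  intro z
  set t := (SameCycle.setoid f).merge x y
  have hz : t z (f z) := setoid_le_iff.1 (Setoid.le_merge _ x y) z
  have hxy : t x y := Setoid.merge_rel _ x y
  rw [mul_apply, swap_apply_def]
  split_ifs with h h
  · exact t.trans (h ▸ hz) hxy
  · exact t.trans (h ▸ hz) (t.symm hxy)
  · exact hz

variable [Finite α]

theorem sameCycle_swap_mul {f : Perm α} {x y : α} (h : ¬ SameCycle f x y) :
    SameCycle (swap x y * f) x y := by
  have hper : 0 < Function.minimalPeriod f x := by
    obtain ⟨n, hn, hfn⟩ := isOfFinOrder_iff_pow_eq_one.1 (isOfFinOrder_of_finite f)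
    refine Function.IsPeriodicPt.minimalPeriod_pos hn ?_
    rw [Function.IsPeriodicPt, Function.IsFixedPt, ← coe_pow, hfn, one_apply]
  have key : ∀ j < Function.minimalPeriod f x, ((swap x y * f) ^ j) x = (f ^ j) x := by
    intro j
    induction j with
    | zero => simp
    | succ j ih =>
      intro hj
      rw [pow_succ', mul_apply, ih (by omega), mul_apply, ← mul_apply f, ← pow_succ']
      refine swap_apply_of_ne_of_ne (fun hx => ?_) fun hy => h ⟨(j + 1 : ℕ), by rwa [zpow_natCast]⟩
      refine Function.not_isPeriodicPt_of_pos_of_lt_minimalPeriod (Nat.succ_ne_zero j) hj ?_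
      rwa [Function.IsPeriodicPt, Function.IsFixedPt, ← coe_pow]
  obtain ⟨m, hm⟩ := Nat.exists_eq_succ_of_ne_zero hper.ne'
  refine ⟨(m + 1 : ℕ), ?_⟩
  have hfix := Function.isPeriodicPt_minimalPeriod f x
  rw [hm, Function.IsPeriodicPt, Function.IsFixedPt, ← coe_pow] at hfix
  rw [zpow_natCast, pow_succ', mul_apply, key m (by omega), mul_apply, ← mul_apply f, ← pow_succ',
    hfix, swap_apply_left]

theorem setoid_le_swap_mul {f : Perm α} {x y : α} (h : ¬ SameCycle f x y) :
    SameCycle.setoid f ≤ SameCycle.setoid (swap x y * f) := by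
  have hle := setoid_swap_mul_le (swap x y * f) x y
  rw [swap_mul_self_mul] at hle
  exact hle.trans (Setoid.merge_le le_rfl (sameCycle_swap_mul h))

theorem numOrbits_swap_mul_le (f : Perm α) (x y : α) :
    numOrbits (swap x y * f) ≤ numOrbits f + 1 := by
  have hle := setoid_swap_mul_le (swap x y * f) x y
  rw [swap_mul_self_mul] at hle
  exact (Setoid.card_quotient_le_merge _ x y).trans
    (Nat.add_le_add_right (Setoid.card_quotient_le hle) 1)

theorem numOrbits_swap_mul {f : Perm α} {x y : α} (h : ¬ SameCycle f x y) :
    numOrbits (swap x y * f) + 1 = numOrbits f := by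
  refine le_antisymm
    (Setoid.card_quotient_lt (setoid_le_swap_mul h) h (sameCycle_swap_mul h)) ?_
  have := numOrbits_swap_mul_le (swap x y * f) x y
  rwa [swap_mul_self_mul] at this

/-- Every permutation is built from the identity by transpositions, each of which merges two
cycles. -/
theorem merge_induction {motive : Perm α → Prop} (one : motive 1)
    (swap_mul : ∀ f x y, ¬ SameCycle f x y → motive f → motive (swap x y * f)) (f : Perm α) :
    motive f := by
  have := Fintype.ofFinite α
  induction hn : f.support.card using Nat.strong_induction_on generalizing f with
  | _ n ih =>
    by_cases hf : f = 1
    · exact hf ▸ one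
    obtain ⟨x, hx⟩ : ∃ x, f x ≠ x := by
      by_contra! h
      exact hf (ext h)
    have hs := swap_mul (swap x (f x) * f) x (f x) ?_
      (ih _ (hn ▸ card_support_swap_mul hx) _ rfl)
    · rwa [swap_mul_self_mul] at hs
    · intro h
      have hfix : Function.IsFixedPt (swap x (f x) * f) x := by
        rw [Function.IsFixedPt, mul_apply, swap_apply_right]
      exact hx (h.eq_of_left hfix).symm

theorem sign_eq_neg_one_pow_numOrbits [Fintype α] (f : Perm α) :
    sign f = (-1) ^ (Nat.card α + numOrbits f) := by
  induction f using merge_induction with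
  | one => rw [numOrbits_one, sign_one, (Even.add_self _).neg_one_pow]
  | swap_mul f x y h ih =>
    have hne : x ≠ y := fun hxy => h (hxy ▸ SameCycle.refl f x)
    rw [sign_mul, sign_swap hne, ih, ← numOrbits_swap_mul h, ← add_assoc, pow_succ]
    simp

theorem even_numOrbits (a b : Perm α) :
    Even (numOrbits a + numOrbits b + numOrbits (a⁻¹ * b) + Nat.card α) := by
  have := Fintype.ofFinite α
  have h := sign_mul a⁻¹ b
  rw [sign_inv, sign_eq_neg_one_pow_numOrbits, sign_eq_neg_one_pow_numOrbits a,
    sign_eq_neg_one_pow_numOrbits b, ← pow_add] at h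
  have h' : ((-1 : ℤˣ)) ^ ((Nat.card α + numOrbits (a⁻¹ * b)) +
      (Nat.card α + numOrbits a + (Nat.card α + numOrbits b))) = 1 := by
    rw [pow_add, h, ← pow_add, (Even.add_self _).neg_one_pow]
  rw [neg_one_pow_eq_one_iff_even (by decide)] at h'
  grind

/-- The Riemann–Hurwitz inequality for a pair of permutations. -/
theorem numOrbits_add_le (a b : Perm α) :
    numOrbits a + numOrbits b + numOrbits (a⁻¹ * b) ≤
      Nat.card α + 2 * Nat.card (Quotient (SameCycle.setoid a ⊔ SameCycle.setoid b)) := by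
  induction b using merge_induction with
  | one =>
    have hinv : SameCycle.setoid (a⁻¹ * 1) = SameCycle.setoid a := by
      ext x y
      rw [mul_one]
      exact sameCycle_inv
    have hone : SameCycle.setoid a ⊔ SameCycle.setoid 1 = SameCycle.setoid a :=
      sup_eq_left.2 (setoid_le_iff.2 fun z => (SameCycle.setoid a).refl z)
    rw [numOrbits_one, hone, numOrbits, numOrbits, hinv]
    omega
  | swap_mul b x y h ih =>
    set R := SameCycle.setoid a ⊔ SameCycle.setoid b with hR
    set R' := SameCycle.setoid a ⊔ SameCycle.setoid (swap x y * b) with hR'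
    have hb := numOrbits_swap_mul h
    have hconj : a⁻¹ * (swap x y * b) = swap (a⁻¹ x) (a⁻¹ y) * (a⁻¹ * b) := by
      rw [← mul_assoc, mul_swap_eq_swap_mul, mul_assoc]
    have hle : R' ≤ R.merge x y :=
      sup_le (le_sup_left.trans (Setoid.le_merge R x y))
        ((setoid_swap_mul_le b x y).trans (Setoid.merge_mono le_sup_right x y))
    by_cases hxy : R x y
    · have h1 := Setoid.card_quotient_le (hle.trans (Setoid.merge_le le_rfl hxy))
      have h2 := numOrbits_swap_mul_le (a⁻¹ * b) (a⁻¹ x) (a⁻¹ y)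
      rw [hconj]
      omega
    · have h1 := (Setoid.card_quotient_le_merge R x y).trans
        (Nat.add_le_add_right (Setoid.card_quotient_le hle) 1)
      have ha : ∀ z, R (a⁻¹ z) z := fun z => by
        have := setoid_le_iff.1 (le_sup_left : SameCycle.setoid a ≤ R) (a⁻¹ z)
        rwa [← mul_apply, mul_inv_cancel, one_apply] at this
      have hbR := setoid_le_iff.1 (le_sup_right : SameCycle.setoid b ≤ R)
      have hab : SameCycle.setoid (a⁻¹ * b) ≤ R :=
        setoid_le_iff.2 fun z => R.trans (hbR z) (R.symm (ha (b z)))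
      have h2 := numOrbits_swap_mul (f := a⁻¹ * b) (x := a⁻¹ x) (y := a⁻¹ y) fun hs =>
        hxy (R.trans (R.symm (ha x)) (R.trans (hab hs) (ha y)))
      rw [hconj]
      omega

theorem card_eq_two_mul_numOrbits {f : Perm α} (hinv : f * f = 1) (hfpf : ∀ x, f x ≠ x) :
    Nat.card α = 2 * numOrbits f := by
  classical
  have := Fintype.ofFinite α
  have hsq : f ^ 2 = 1 := by rw [pow_two, hinv]
  have hsame : ∀ x z, SameCycle f x z ↔ z = x ∨ z = f x := by
    refine fun x z => ⟨?_, ?_⟩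
    · rintro ⟨i, rfl⟩
      obtain ⟨k, rfl | rfl⟩ := Int.even_or_odd' i <;>
        simp [zpow_add, zpow_mul, hsq]
    · rintro (rfl | rfl)
      · exact SameCycle.refl f z
      · exact sameCycle_apply_right.2 (SameCycle.refl f x)
  rw [numOrbits, Nat.card_eq_fintype_card, Nat.card_eq_fintype_card, ← Finset.card_univ,
    Finset.card_eq_sum_card_fiberwise (t := Finset.univ)
      (f := Quotient.mk (SameCycle.setoid f)) (by simp),
    Finset.sum_const_nat (m := 2), Finset.card_univ, mul_comm]
  intro q _
  induction q using Quotient.inductionOn with | h x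
  rw [← Finset.card_pair (hfpf x).symm]
  congr 1
  ext z
  simp only [Finset.mem_filter, Finset.mem_univ, true_and, Finset.mem_insert,
    Finset.mem_singleton, ← hsame]
  rw [Quotient.eq]
  exact sameCycle_comm

end Equiv.Perm



/-- A ribbon graph is encoded as a triple `(X, σ₀, σ₁)`: `X` is the finite nonempty
set of oriented edges, `σ₁` is the fixed-point-free involution reversing
orientations, `σ₀` is a permutation whose orbits are the vertices, and the orbits of
`σ_∞ = σ₀⁻¹ ∘ σ₁` are the boundary cycles.  For a connected ribbon graph with `v`
vertices, `e` edges and `c` boundary cycles one has `v − e + c ≤ 2` and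
`v − e + c ≡ 0 (mod 2)`; i.e. there is a nonnegative integer `g` (the genus) with
`v − e + c = 2 − 2g`. -/
theorem ribbon_graph_euler_characteristic (X : Type) [Fintype X] [Nonempty X]
    (σ0 σ1 : Equiv.Perm X)
    (hinv : σ1 * σ1 = 1) (hfpf : ∀ x : X, σ1 x ≠ x)
    (hconn : ∀ x y : X, y ∈ orbit (Subgroup.closure ({σ0, σ1} : Set (Equiv.Perm X))) x)
    (v e c : ℕ)
    (hv : v = Nat.card (orbitRel.Quotient (Subgroup.zpowers σ0) X))
    (he : e = Nat.card (orbitRel.Quotient (Subgroup.zpowers σ1) X))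
    (hc : c = Nat.card (orbitRel.Quotient (Subgroup.zpowers (σ0⁻¹ * σ1)) X)) :
    v + c ≤ e + 2 ∧ ∃ g : ℕ, v + c + 2 * g = e + 2 := by
  classical
  have hle := numOrbits_add_le σ0 σ1
  have heven := even_numOrbits σ0 σ1
  have hcard := card_eq_two_mul_numOrbits hinv hfpf
  have hone : Nat.card (Quotient (SameCycle.setoid σ0 ⊔ SameCycle.setoid σ1)) ≤ 1 := by
    rw [setoid_sup_eq_top hconn, Finite.card_le_one_iff_subsingleton]
    exact ⟨fun p q => Quotient.inductionOn₂ p q fun _ _ => Quotient.sound trivial⟩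
  rw [card_orbitRel_zpowers] at hv he hc
  obtain ⟨k, hk⟩ := heven
  exact ⟨by omega, 2 * e + 1 - k, by omega⟩
end

section
/- Fix integers g ≥ 0 and n ≥ 1 with 2g − 2 + n > 0. Every connected n-pointed ribbon graph of genus g has at most 6g − 6 + 3n edges, and there are only finitely many isomorphism classes of connected n-pointed ribbon graphs of genus g. -/
/-- A connected `n`-pointed ribbon graph: a finite nonempty set `X` of oriented edges,
a fixed-point-free involution `σ₁` (orientation reversal), a permutation `σ₀` whose
orbits are the vertices (the orbits of `σ_∞ = σ₀⁻¹ ∘ σ₁` being the boundary cycles),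
such that the group generated by `σ₀, σ₁` acts transitively on `X`, together with an
injection `y` from `{1,…,n}` into (boundary cycles) ⊔ (vertices) whose image contains
every boundary cycle and every vertex of degree `≤ 2`. -/
structure ConnPointedRibbonGraph (n : ℕ) : Type 1 where
  X : Type
  fintypeX : Fintype X
  nonemptyX : Nonempty X
  σ0 : Equiv.Perm X
  σ1 : Equiv.Perm X
  invol : σ1 * σ1 = 1
  fpf : ∀ x : X, σ1 x ≠ x
  conn : ∀ x y : X, y ∈ MulAction.orbit (Subgroup.closure ({σ0, σ1} : Set (Equiv.Perm X))) x
  y : Fin n →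
    (MulAction.orbitRel.Quotient (Subgroup.zpowers (σ0⁻¹ * σ1)) X) ⊕
      (MulAction.orbitRel.Quotient (Subgroup.zpowers σ0) X)
  yinj : Function.Injective y
  ybd : ∀ b : MulAction.orbitRel.Quotient (Subgroup.zpowers (σ0⁻¹ * σ1)) X,
    ∃ i, y i = Sum.inl b
  yvert : ∀ vtx : MulAction.orbitRel.Quotient (Subgroup.zpowers σ0) X,
    Nat.card vtx.orbit ≤ 2 → ∃ i, y i = Sum.inr vtx

namespace ConnPointedRibbonGraph

variable {n : ℕ}

/-- Number of vertices. -/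
noncomputable def v (G : ConnPointedRibbonGraph n) : ℕ :=
  Nat.card (MulAction.orbitRel.Quotient (Subgroup.zpowers G.σ0) G.X)

/-- Number of edges. -/
noncomputable def e (G : ConnPointedRibbonGraph n) : ℕ :=
  Nat.card (MulAction.orbitRel.Quotient (Subgroup.zpowers G.σ1) G.X)

/-- Number of boundary cycles. -/
noncomputable def c (G : ConnPointedRibbonGraph n) : ℕ :=
  Nat.card (MulAction.orbitRel.Quotient (Subgroup.zpowers (G.σ0⁻¹ * G.σ1)) G.X)

/-- `G` has genus `g`, i.e. `v − e + c = 2 − 2g`. -/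
def GenusIs (G : ConnPointedRibbonGraph n) (g : ℕ) : Prop :=
  G.v + G.c + 2 * g = G.e + 2

/-- Isomorphism of `n`-pointed ribbon graphs: a bijection of oriented-edge sets
conjugating `σ₀` to `σ₀′` and `σ₁` to `σ₁′`, and carrying the `i`-th marked vertex
or boundary cycle of `G` to that of `G'`. -/
def Iso (G G' : ConnPointedRibbonGraph n) : Prop :=
  ∃ f : G.X ≃ G'.X,
    (∀ x, f (G.σ0 x) = G'.σ0 (f x)) ∧
    (∀ x, f (G.σ1 x) = G'.σ1 (f x)) ∧
    (∀ (i : Fin n) (x : G.X),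
      (G.y i = Sum.inl (Quotient.mk'' x) → G'.y i = Sum.inl (Quotient.mk'' (f x))) ∧
      (G.y i = Sum.inr (Quotient.mk'' x) → G'.y i = Sum.inr (Quotient.mk'' (f x))))

end ConnPointedRibbonGraph

namespace ConnPointedRibbonGraph

variable {n : ℕ}

theorem finite_X (G : ConnPointedRibbonGraph n) : Finite G.X :=
  haveI := G.fintypeX
  inferInstance

/-- An involution on a finite type has at least half as many orbits as there are points. -/
theorem card_le_two_mul_card_orbits {X : Type*} [Finite X] (s : Equiv.Perm X) (hs : s * s = 1) :
    Nat.card X ≤ 2 * Nat.card (MulAction.orbitRel.Quotient (Subgroup.zpowers s) X) := by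
  classical
  have := Fintype.ofFinite (MulAction.orbitRel.Quotient (Subgroup.zpowers s) X)
  rw [Nat.card_congr (MulAction.selfEquivSigmaOrbits' (Subgroup.zpowers s) X), Nat.card_sigma,
    Nat.card_eq_fintype_card, mul_comm, ← smul_eq_mul, ← Finset.card_univ, ← Finset.sum_const]
  refine Finset.sum_le_sum fun ω _ => ?_
  induction ω using Quotient.inductionOn' with | h x => ?_
  have hsub : MulAction.orbitRel.Quotient.orbit
      (Quotient.mk'' x : MulAction.orbitRel.Quotient (Subgroup.zpowers s) X) ⊆
      ({x, s x} : Set X) := by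
    rw [MulAction.orbitRel.Quotient.orbit_mk]
    rintro _ ⟨⟨_, k, rfl⟩, rfl⟩
    have h2 : s ^ (2 : ℤ) = 1 := by rw [zpow_two, hs]
    rcases Int.even_or_odd' k with ⟨m, rfl | rfl⟩
    · left
      change (s ^ (2 * m)) x = x
      simp [zpow_mul, h2]
    · right
      change (s ^ (2 * m + 1)) x = s x
      simp [zpow_add, zpow_mul, h2]
  calc _ ≤ Set.ncard {x, s x} := Set.ncard_le_ncard hsub (Set.toFinite _)
    _ ≤ 2 := (Set.ncard_insert_le _ _).trans (by simp)

theorem card_X_le (G : ConnPointedRibbonGraph n) : Nat.card G.X ≤ 2 * G.e :=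
  haveI := G.finite_X
  card_le_two_mul_card_orbits G.σ1 G.invol

/-- The set of marked vertices. -/
def markedVertices (G : ConnPointedRibbonGraph n) :
    Set (MulAction.orbitRel.Quotient (Subgroup.zpowers G.σ0) G.X) :=
  {ω | ∃ i, G.y i = Sum.inr ω}

theorem c_add_ncard_markedVertices_le (G : ConnPointedRibbonGraph n) :
    G.c + G.markedVertices.ncard ≤ n := by
  have := G.finite_X
  have hex : ∀ p : MulAction.orbitRel.Quotient (Subgroup.zpowers (G.σ0⁻¹ * G.σ1)) G.X ⊕
      G.markedVertices, ∃ i, G.y i = Sum.map id Subtype.val p := by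
    rintro (b | ⟨ω, hω⟩)
    · exact G.ybd b
    · exact hω
  choose f hf using hex
  have hinj : Function.Injective f := fun p q hpq =>
    Function.injective_id.sumMap Subtype.val_injective (by rw [← hf, ← hf, hpq])
  have h := Nat.card_le_card_of_injective f hinj
  rwa [Nat.card_sum, Nat.card_fin] at h

theorem three_mul_v_le (G : ConnPointedRibbonGraph n) :
    3 * G.v ≤ Nat.card G.X + 2 * G.markedVertices.ncard := by
  classical
  have := G.finite_X
  have := Fintype.ofFinite (MulAction.orbitRel.Quotient (Subgroup.zpowers G.σ0) G.X)
  have hM : 2 * G.markedVertices.ncard = ∑ ω, if ω ∈ G.markedVertices then 2 else 0 := by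
    simp [← Finset.sum_filter, Set.ncard_eq_toFinset_card', Set.toFinset, mul_comm,
      Fintype.card_subtype]
  rw [hM, v, Nat.card_congr (MulAction.selfEquivSigmaOrbits' (Subgroup.zpowers G.σ0) G.X),
    Nat.card_sigma, Nat.card_eq_fintype_card, mul_comm, ← smul_eq_mul, ← Finset.card_univ,
    ← Finset.sum_const, ← Finset.sum_add_distrib]
  refine Finset.sum_le_sum fun ω _ => ?_
  split_ifs with h
  · have : 0 < Nat.card ω.orbit :=
      have := ω.nonempty_orbit.to_subtype
      Nat.card_pos
    omega
  · have : ¬ Nat.card ω.orbit ≤ 2 := fun h' => h (G.yvert ω h')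
    omega

theorem GenusIs.e_le {G : ConnPointedRibbonGraph n} {g : ℕ} (h : G.GenusIs g) :
    G.e + 6 ≤ 6 * g + 3 * n := by
  have h1 := G.card_X_le
  have h2 := G.c_add_ncard_markedVertices_le
  have h3 := G.three_mul_v_le
  unfold GenusIs at h
  omega

/-- The structure of `G` transported along an embedding of its oriented edges. -/
def code (G : ConnPointedRibbonGraph n) {α : Type*} (a : G.X ↪ α) :
    Set α × Set (α × α) × Set (α × α) × Set (Fin n × α) × Set (Fin n × α) :=
  (Set.range a,
    Set.range fun x => (a x, a (G.σ0 x)),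
    Set.range fun x => (a x, a (G.σ1 x)),
    {p | ∃ x, a x = p.2 ∧ G.y p.1 = Sum.inl (Quotient.mk'' x)},
    {p | ∃ x, a x = p.2 ∧ G.y p.1 = Sum.inr (Quotient.mk'' x)})

theorem Iso.of_code_eq {G G' : ConnPointedRibbonGraph n} {α : Type*} (a : G.X ↪ α)
    (a' : G'.X ↪ α) (h : G.code a = G'.code a') : G.Iso G' := by
  simp only [code, Prod.mk.injEq] at h
  obtain ⟨hX, h0, h1, hl, hr⟩ := h
  let f : G.X ≃ G'.X :=
    (Equiv.ofInjective a a.injective).trans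
      ((Equiv.setCongr hX).trans (Equiv.ofInjective a' a'.injective).symm)
  have hf (x : G.X) : a' (f x) = a x := by
    simp [f, Equiv.apply_ofInjective_symm]
  refine ⟨f, fun x => ?_, fun x => ?_, fun i x => ⟨fun hx => ?_, fun hx => ?_⟩⟩
  · obtain ⟨z, hz⟩ := h0.subset ⟨x, rfl⟩
    simp only [Prod.mk.injEq, ← hf, a'.injective.eq_iff] at hz
    rw [← hz.2, hz.1]
  · obtain ⟨z, hz⟩ := h1.subset ⟨x, rfl⟩
    simp only [Prod.mk.injEq, ← hf, a'.injective.eq_iff] at hz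
    rw [← hz.2, hz.1]
  · obtain ⟨z, hz, hy⟩ := hl.subset (show (i, a x) ∈ _ from ⟨x, rfl, hx⟩)
    simp only [← hf, a'.injective.eq_iff] at hz
    rw [← hz, hy]
  · obtain ⟨z, hz, hy⟩ := hr.subset (show (i, a x) ∈ _ from ⟨x, rfl, hx⟩)
    simp only [← hf, a'.injective.eq_iff] at hz
    rw [← hz, hy]

theorem GenusIs.nonempty_embedding {G : ConnPointedRibbonGraph n} {g : ℕ} (h : G.GenusIs g) :
    Nonempty (G.X ↪ Fin (2 * (6 * g + 3 * n))) := by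
  have := G.fintypeX
  refine Function.Embedding.nonempty_of_card_le ?_
  have h1 := G.card_X_le
  have h2 := h.e_le
  rw [Nat.card_eq_fintype_card] at h1
  rw [Fintype.card_fin]
  omega

end ConnPointedRibbonGraph

/-- Fix `g ≥ 0`, `n ≥ 1` with `2g − 2 + n > 0`.  Every connected `n`-pointed ribbon
graph of genus `g` has at most `6g − 6 + 3n` edges, and there are only finitely many
isomorphism classes of connected `n`-pointed ribbon graphs of genus `g`. -/
theorem ribbon_graphs_of_genus_finitely_many (g n : ℕ) (hn : 1 ≤ n) (hstab : 2 < 2 * g + n) :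
    (∀ G : ConnPointedRibbonGraph n, G.GenusIs g → G.e + 6 ≤ 6 * g + 3 * n) ∧
    Finite (Quotient (Relation.EqvGen.setoid
      (fun G G' : {G : ConnPointedRibbonGraph n // G.GenusIs g} =>
        ConnPointedRibbonGraph.Iso G.1 G'.1))) := by
  refine ⟨fun G hG => hG.e_le, ?_⟩
  let a (G : {G : ConnPointedRibbonGraph n // G.GenusIs g}) := G.2.nonempty_embedding.some
  refine Finite.of_injective (fun q => (Quotient.out q).1.code (a (Quotient.out q)))
    fun p q hpq => ?_
  rw [← Quotient.out_eq p, ← Quotient.out_eq q]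
  exact Quotient.sound (Relation.EqvGen.rel _ _ (.of_code_eq _ _ hpq))
end
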